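/- PIF stabilizes from RQ' ∨ RP': every maximal computation of PIF that starts in a state satisfying RQ'(l,m) for some 0 ≤ l < m ≤ N, or RP'(k) for some 1 ≤ k ≤ N−1, contains a state satisfying RQ(l',m') for some 0 ≤ l' < m' ≤ N or RP(k') for some 1 ≤ k' ≤ N−1. -/

import Mathlib

/-- Values of the state variable of a PIF process: idle, requesting, replying. -/
inductive PSt where
  | idle | rq | rp
deriving DecidableEq

/-- A PIF state on the chain of `N` processes is valid if the root (process 1)
never holds `rp` and the leaf (process `N`) never holds `rq`. -/
def PifValid (N : ℕ) (st : ℕ → PSt) : Prop := st 1 ≠ PSt.rp ∧ st N ≠ PSt.rq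

/-- One step of the PIF program on the chain of `N` processes: `st'` is
obtained from `st` by executing one enabled action (request, clear, forward,
back, stop, reflect or reset). -/
def pifStep (N : ℕ) (st st' : ℕ → PSt) : Prop :=
  -- request (root)
  (st 1 = PSt.idle ∧ st 2 = PSt.idle ∧ st' = Function.update st 1 PSt.rq) ∨
  -- clear (root)
  (st 1 = PSt.rq ∧ st 2 = PSt.rp ∧ st' = Function.update st 1 PSt.idle) ∨
  -- forward (intermediate)
  (∃ j, 2 ≤ j ∧ j ≤ N - 1 ∧ st (j - 1) = PSt.rq ∧ st j = PSt.idle ∧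
    st (j + 1) = PSt.idle ∧ st' = Function.update st j PSt.rq) ∨
  -- back (intermediate)
  (∃ j, 2 ≤ j ∧ j ≤ N - 1 ∧ st (j - 1) = PSt.rq ∧ st j = PSt.rq ∧
    st (j + 1) = PSt.rp ∧ st' = Function.update st j PSt.rp) ∨
  -- stop (intermediate)
  (∃ j, 2 ≤ j ∧ j ≤ N - 1 ∧ st (j - 1) = PSt.idle ∧ st j ≠ PSt.idle ∧
    st' = Function.update st j PSt.idle) ∨
  -- reflect (leaf)
  (st (N - 1) = PSt.rq ∧ st N = PSt.idle ∧ st' = Function.update st N PSt.rp) ∨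
  -- reset (leaf)
  (st (N - 1) = PSt.idle ∧ st N = PSt.rp ∧ st' = Function.update st N PSt.idle)

/-- `RP N k st`: the `k` leftmost processes are requesting and the rest are
replying (`1 ≤ k ≤ N - 1`). -/
def RP (N k : ℕ) (st : ℕ → PSt) : Prop :=
  1 ≤ k ∧ k ≤ N - 1 ∧
  (∀ j, 1 ≤ j → j ≤ k → st j = PSt.rq) ∧
  (∀ j, k < j → j ≤ N → st j = PSt.rp)

/-- `RQ N l m st`: the `l` leftmost processes are requesting, processes
`l+1 .. m` are idle, and the rest are replying (`0 ≤ l < m ≤ N`). -/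
def RQ (N l m : ℕ) (st : ℕ → PSt) : Prop :=
  l < m ∧ m ≤ N ∧
  (∀ j, 1 ≤ j → j ≤ l → st j = PSt.rq) ∧
  (∀ j, l < j → j ≤ m → st j = PSt.idle) ∧
  (∀ j, m < j → j ≤ N → st j = PSt.rp)

/-- `RP' N k st`: the `k` leftmost processes are requesting, process `k+1` is
replying, and no process beyond `k+1` is idle (`1 ≤ k ≤ N - 1`). -/
def RP' (N k : ℕ) (st : ℕ → PSt) : Prop :=
  1 ≤ k ∧ k ≤ N - 1 ∧
  (∀ j, 1 ≤ j → j ≤ k → st j = PSt.rq) ∧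
  st (k + 1) = PSt.rp ∧
  (∀ j, k + 1 < j → j ≤ N → st j ≠ PSt.idle)

/-- `RQ' N l m st`: the `l` leftmost processes are requesting, processes
`l+1 .. m` are idle, and the remaining processes are arbitrary
(`0 ≤ l < m ≤ N`). -/
def RQ' (N l m : ℕ) (st : ℕ → PSt) : Prop :=
  l < m ∧ m ≤ N ∧
  (∀ j, 1 ≤ j → j ≤ l → st j = PSt.rq) ∧
  (∀ j, l < j → j ≤ m → st j = PSt.idle)

/-- A maximal computation of `PIF`: at each index, either an enabled action is
executed, or no action is enabled and the state stutters (this models finite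
maximal computations by repeating the final state). -/
def pifComputation (N : ℕ) (c : ℕ → (ℕ → PSt)) : Prop :=
  ∀ n, pifStep N (c n) (c (n + 1)) ∨
    ((∀ st', ¬ pifStep N (c n) st') ∧ c (n + 1) = c n)

theorem rqStep (N : ℕ) (hN : 3 ≤ N) (st st' : ℕ → PSt) (l m : ℕ) (h : RQ' N l m st)
    (hs : pifStep N st st') : (∃ l m, RQ' N l m st') ∨ ∃ k, RP N k st' := by
  obtain ⟨hlm, hmN, h1, h2⟩ := h
  rcases hs with ⟨a, b, rfl⟩ | ⟨a, b, rfl⟩ | ⟨j, hj, hj', a, b, d, rfl⟩ | ⟨j, hj, hj', a, b, d, rfl⟩ |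
    ⟨j, hj, hj', a, b, rfl⟩ | ⟨a, b, rfl⟩ | ⟨a, b, rfl⟩
  · have : l = 0 := by
      by_contra hl
      have := h1 1 le_rfl (by omega)
      simp_all
    subst this
    left
    refine ⟨1, max m 2, by omega, by omega, ?_, ?_⟩
    · intro j _ _
      have : j = 1 := by omega
      subst this; simp
    · intro j hj hj'
      rw [Function.update_of_ne (by omega)]
      by_cases h : j ≤ m
      · exact h2 j (by omega) h
      · have : j = 2 := by omega
        subst this; exact b
  · exfalso
    have h11 := h1 1
    have h21 := h2 1
    have h12 := h1 2
    have h22 := h2 2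
    grind
  · left
    by_cases hjm : m < j
    · exact ⟨l, m, hlm, hmN, fun i _ _ => by rw [Function.update_of_ne (by omega)]; grind,
        fun i _ _ => by rw [Function.update_of_ne (by omega)]; grind⟩
    · have : j = l + 1 := by
        have := h1 j
        have := h2 (j-1)
        grind
      refine ⟨j, max m (j+1), by omega, by omega, ?_, ?_⟩
      · intro i _ _
        by_cases h : i = j
        · subst h; simp
        · rw [Function.update_of_ne h]; grind
      · intro i _ _
        rw [Function.update_of_ne (by omega)]
        by_cases h : i ≤ m
        · grind
        · have : i = j + 1 := by omega
          subst this; exact d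
  · left
    have hjm : m < j := by
      by_contra hh
      have := h2 j
      have := h1 (j+1)
      have := h2 (j+1)
      grind
    exact ⟨l, m, hlm, hmN, fun i _ _ => by rw [Function.update_of_ne (by omega)]; grind,
        fun i _ _ => by rw [Function.update_of_ne (by omega)]; grind⟩
  · left
    have hjm : m < j := by
      by_contra hh
      have := h1 (j-1)
      have := h2 j
      grind
    exact ⟨l, m, hlm, hmN, fun i _ _ => by rw [Function.update_of_ne (by omega)]; grind,
        fun i _ _ => by rw [Function.update_of_ne (by omega)]; grind⟩
  · by_cases hjm : m < N
    · left
      exact ⟨l, m, hlm, hmN, fun i _ _ => by rw [Function.update_of_ne (by omega)]; grind,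
        fun i _ _ => by rw [Function.update_of_ne (by omega)]; grind⟩
    · right
      have : l = N - 1 := by
        have := h2 (N-1)
        grind
      refine ⟨N-1, by omega, le_rfl, fun i _ _ => by rw [Function.update_of_ne (by omega)]; grind, ?_⟩
      intro i _ _
      have : i = N := by omega
      subst this; simp
  · left
    have hjm : m < N := by
      by_contra hh
      have := h1 (N-1)
      have := h2 N
      grind
    exact ⟨l, m, hlm, hmN, fun i _ _ => by rw [Function.update_of_ne (by omega)]; grind,
        fun i _ _ => by rw [Function.update_of_ne (by omega)]; grind⟩

theorem rpStep (N : ℕ) (hN : 3 ≤ N) (st st' : ℕ → PSt) (k : ℕ) (h : RP' N k st)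
    (hs : pifStep N st st') : (∃ l m, RQ' N l m st') ∨ ∃ k, RP' N k st' := by
  obtain ⟨hk, hkN, h1, h2, h3⟩ := h
  have hni : ∀ j, 1 ≤ j → j ≤ N → st j ≠ PSt.idle := by
    intro j _ _
    have := h1 j
    have := h3 j
    grind
  rcases hs with ⟨a, b, rfl⟩ | ⟨a, b, rfl⟩ | ⟨j, hj, hj', a, b, d, rfl⟩ | ⟨j, hj, hj', a, b, d, rfl⟩ |
    ⟨j, hj, hj', a, b, rfl⟩ | ⟨a, b, rfl⟩ | ⟨a, b, rfl⟩
  · exact absurd a (hni 1 (by omega) (by omega))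
  · left
    refine ⟨0, 1, by omega, by omega, by intros; omega, ?_⟩
    intro j _ _
    have : j = 1 := by omega
    subst this; simp
  · exact absurd b (hni j (by omega) (by omega))
  · right
    by_cases hjk : j ≤ k
    · have : j = k := by
        have := h1 (j+1)
        grind
      subst this
      refine ⟨j - 1, by omega, by omega, fun i _ _ => by rw [Function.update_of_ne (by omega)]; grind, ?_, ?_⟩
      · have : j - 1 + 1 = j := by omega
        rw [this]; simp
      · intro i _ _
        rw [Function.update_of_ne (by omega)]
        exact hni i (by omega) (by omega)
    · have : j ≠ k + 1 := by grind
      refine ⟨k, by omega, by omega, fun i _ _ => by rw [Function.update_of_ne (by omega)]; grind, ?_, ?_⟩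
      · rw [Function.update_of_ne (by omega)]; exact h2
      · intro i _ _
        by_cases h : i = j
        · subst h; simp
        · rw [Function.update_of_ne h]
          exact hni i (by omega) (by omega)
  · exact absurd a (hni (j-1) (by omega) (by omega))
  · exact absurd b (hni N (by omega) (by omega))
  · exact absurd a (hni (N-1) (by omega) (by omega))

/-- A sequence whose rank under an injective bounded function is monotone is eventually constant. -/
theorem evConst (f : ℕ → PSt) (r : PSt → ℕ) (hr : Function.Injective r) (hb : ∀ x, r x ≤ 2)
    (n0 : ℕ) (hm : ∀ n, n0 ≤ n → r (f n) ≤ r (f (n+1))) :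
    ∃ n1 v, ∀ n, n1 ≤ n → f n = v := by
  have mono : ∀ a b, n0 ≤ a → a ≤ b → r (f a) ≤ r (f b) := by
    intro a b ha hab
    induction b, hab using Nat.le_induction with
    | base => exact le_rfl
    | succ b hb' ih => exact ih.trans (hm b (by omega))
  by_contra hcon
  push Not at hcon
  have : ∀ k, ∃ n, n0 ≤ n ∧ k ≤ r (f n) := by
    intro k
    induction k with
    | zero => exact ⟨n0, le_rfl, Nat.zero_le _⟩
    | succ k ih =>
      obtain ⟨n, hn, hk⟩ := ih
      obtain ⟨n', hn', hne⟩ := hcon n (f n)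
      have h1 := mono n n' hn hn'
      have h2 : r (f n') ≠ r (f n) := fun h => hne (hr h)
      exact ⟨n', by omega, by omega⟩
  obtain ⟨n, _, h⟩ := this 3
  have := hb (f n)
  omega

def rankA : PSt → ℕ
  | .idle => 0 | .rq => 1 | .rp => 2
def rankB : PSt → ℕ
  | .idle => 2 | .rq => 0 | .rp => 1

theorem rankA_inj : Function.Injective rankA := by
  intro a b; cases a <;> cases b <;> simp [rankA]
theorem rankB_inj : Function.Injective rankB := by
  intro a b; cases a <;> cases b <;> simp [rankB]
theorem rankA_le (x : PSt) : rankA x ≤ 2 := by cases x <;> simp [rankA]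
theorem rankB_le (x : PSt) : rankB x ≤ 2 := by cases x <;> simp [rankB]

/-- How a non-root process may change in one step. -/
theorem stepAt (N : ℕ) (hN : 3 ≤ N) (st st' : ℕ → PSt) (hs : pifStep N st st') (j : ℕ)
    (hj : 2 ≤ j) : st' j = st j ∨ (st (j-1) = .idle ∧ st' j = .idle) ∨
      (st (j-1) = .rq ∧ ((st j = .idle) ∨ (st j = .rq ∧ st' j = .rp))) := by
  rcases hs with ⟨a, b, rfl⟩ | ⟨a, b, rfl⟩ | ⟨i, hj, hj', a, b, d, rfl⟩ | ⟨i, hj, hj', a, b, d, rfl⟩ |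
    ⟨i, hj, hj', a, b, rfl⟩ | ⟨a, b, rfl⟩ | ⟨a, b, rfl⟩ <;> simp only [Function.update_apply] <;> grind

theorem stepRoot (N : ℕ) (hN : 3 ≤ N) (st st' : ℕ → PSt) (hs : pifStep N st st') :
    st' 1 = st 1 ∨ st 1 = .idle ∨ (st 1 = .rq ∧ st 2 = .rp) := by
  rcases hs with ⟨a, b, rfl⟩ | ⟨a, b, rfl⟩ | ⟨i, hj, hj', a, b, d, rfl⟩ | ⟨i, hj, hj', a, b, d, rfl⟩ |
    ⟨i, hj, hj', a, b, rfl⟩ | ⟨a, b, rfl⟩ | ⟨a, b, rfl⟩ <;> simp only [Function.update_apply] <;> grind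

theorem stepLeaf (N : ℕ) (hN : 3 ≤ N) (st st' : ℕ → PSt) (hs : pifStep N st st')
    (h : st N ≠ .rq) : st' N ≠ .rq := by
  rcases hs with ⟨a, b, rfl⟩ | ⟨a, b, rfl⟩ | ⟨i, hj, hj', a, b, d, rfl⟩ | ⟨i, hj, hj', a, b, d, rfl⟩ |
    ⟨i, hj, hj', a, b, rfl⟩ | ⟨a, b, rfl⟩ | ⟨a, b, rfl⟩ <;> simp only [Function.update_apply] <;> grind

theorem stepChanges (N : ℕ) (hN : 3 ≤ N) (st st' : ℕ → PSt) (hs : pifStep N st st') :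
    ∃ j, 1 ≤ j ∧ j ≤ N ∧ st' j ≠ st j := by
  rcases hs with ⟨a, b, rfl⟩ | ⟨a, b, rfl⟩ | ⟨i, hj, hj', a, b, d, rfl⟩ | ⟨i, hj, hj', a, b, d, rfl⟩ |
    ⟨i, hj, hj', a, b, rfl⟩ | ⟨a, b, rfl⟩ | ⟨a, b, rfl⟩
  · exact ⟨1, by omega, by omega, by simp [a]⟩
  · exact ⟨1, by omega, by omega, by simp [a]⟩
  · exact ⟨i, by omega, by omega, by simp [b]⟩
  · exact ⟨i, by omega, by omega, by simp [b]⟩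
  · exact ⟨i, by omega, by omega, by simpa using b.symm⟩
  · exact ⟨N, by omega, by omega, by simp [b]⟩
  · exact ⟨N, by omega, by omega, by simp [b]⟩

/-- A state of `RP'` enables an action. -/
theorem rpLive (N : ℕ) (hN : 3 ≤ N) (st : ℕ → PSt) (k : ℕ) (h : RP' N k st) :
    ∃ st', pifStep N st st' := by
  obtain ⟨hk, hkN, h1, h2, h3⟩ := h
  by_cases hk1 : k = 1
  · subst hk1
    exact ⟨_, Or.inr (Or.inl ⟨h1 1 le_rfl le_rfl, h2, rfl⟩)⟩
  · exact ⟨_, Or.inr (Or.inr (Or.inr (Or.inl ⟨k, by omega, hkN, h1 _ (by omega) (by omega),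
      h1 _ hk le_rfl, h2, rfl⟩)))⟩

/-- A state of `RQ'` enables an action or satisfies `RQ`. -/
theorem rqLive (N : ℕ) (hN : 3 ≤ N) (st : ℕ → PSt) (hv : st N ≠ .rq) (l m : ℕ)
    (h : RQ' N l m st) : (∃ st', pifStep N st st') ∨ ∃ l m, RQ N l m st := by
  obtain ⟨hlm, hmN, h1, h2⟩ := h
  obtain ⟨d, hd⟩ : ∃ d, N - m = d := ⟨_, rfl⟩
  induction d generalizing m with
  | zero => exact Or.inr ⟨l, m, hlm, hmN, h1, h2, by intros; omega⟩
  | succ d ih =>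
    by_cases hi : st (m+1) = .idle
    · refine ih (m+1) (by omega) (by omega) ?_ (by omega)
      intro j hj hj'
      by_cases h : j ≤ m
      · exact h2 j hj h
      · have : j = m + 1 := by omega
        rw [this, hi]
    · left
      have hm := h2 m hlm le_rfl
      by_cases hmm : m + 1 = N
      · have : st N = .rp := by
          rw [hmm] at hi
          cases h : st N <;> simp_all
        have e : N - 1 = m := by omega
        exact ⟨_, Or.inr (Or.inr (Or.inr (Or.inr (Or.inr (Or.inr ⟨by rw [e]; exact hm, this, rfl⟩)))))⟩
      · exact ⟨_, Or.inr (Or.inr (Or.inr (Or.inr (Or.inl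
          ⟨m+1, by omega, by omega, by simpa using hm, hi, rfl⟩))))⟩

theorem pif_stabilizes (N : ℕ) (hN : 3 ≤ N)
    (c : ℕ → (ℕ → PSt)) (hv : PifValid N (c 0))
    (hc : pifComputation N c)
    (h0 : (∃ l m, RQ' N l m (c 0)) ∨ (∃ k, RP' N k (c 0))) :
    ∃ n, (∃ l m, RQ N l m (c n)) ∨ (∃ k, RP N k (c n)) := by
  by_contra hcon
  push Not at hcon
  have hleaf : ∀ n, c n N ≠ .rq := by
    intro n
    induction n with
    | zero => exact hv.2
    | succ n ih =>
      rcases hc n with h | ⟨-, h⟩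
      · exact stepLeaf N hN _ _ h ih
      · rw [h]; exact ih
  have hrq : ∀ n, (∃ l m, RQ' N l m (c n)) → ∃ l m, RQ' N l m (c (n+1)) := by
    rintro n ⟨l, m, h⟩
    rcases hc n with hs | ⟨-, hs⟩
    · rcases rqStep N hN _ _ l m h hs with h | ⟨k, h⟩
      · exact h
      · exact absurd h ((hcon (n+1)).2 k)
    · rw [hs]; exact ⟨l, m, h⟩
  have hinv : ∀ n, (∃ l m, RQ' N l m (c n)) ∨ (∃ k, RP' N k (c n)) := by
    intro n
    induction n with
    | zero => exact h0
    | succ n ih =>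
      rcases ih with h | ⟨k, h⟩
      · exact Or.inl (hrq n h)
      · rcases hc n with hs | ⟨-, hs⟩
        · exact rpStep N hN _ _ k h hs
        · rw [hs]; exact Or.inr ⟨k, h⟩
  have hroot : ∃ n1 v, ∀ n, n1 ≤ n → c n 1 = v := by
    by_cases hex : ∃ n, ∃ l m, RQ' N l m (c n)
    · obtain ⟨n0, hn0⟩ := hex
      have hall : ∀ n, n0 ≤ n → ∃ l m, RQ' N l m (c n) := by
        intro n hn
        induction n, hn using Nat.le_induction with
        | base => exact hn0
        | succ n _ ih => exact hrq n ih
      refine evConst (fun n => c n 1) rankA rankA_inj rankA_le n0 ?_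
      intro n hn
      obtain ⟨l, m, hlm, hmN, h1, h2⟩ := hall n hn
      rcases hc n with hs | ⟨-, hs⟩
      · rcases stepRoot N hN _ _ hs with h | h | ⟨a, b⟩
        · simp [h]
        · simp [h, rankA]
        · exfalso
          have h11 := h1 1
          have h21 := h2 1
          have h12 := h1 2
          have h22 := h2 2
          grind
      · simp [hs]
    · refine ⟨0, .rq, fun n _ => ?_⟩
      rcases hinv n with h | ⟨k, hk, -, h, -⟩
      · exact absurd ⟨n, h⟩ hex
      · exact h 1 le_rfl hk
  have hev : ∀ j, ∃ n1 v, ∀ n, n1 ≤ n → c n (j+1) = v := by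
    intro j
    induction j with
    | zero => exact hroot
    | succ j ih =>
      obtain ⟨n1, v, hv1⟩ := ih
      have key : ∀ n, n1 ≤ n → c (n+1) (j+1+1) = c n (j+1+1) ∨
          (v = .idle ∧ c (n+1) (j+1+1) = .idle) ∨
          (v = .rq ∧ ((c n (j+1+1) = .idle) ∨ (c n (j+1+1) = .rq ∧ c (n+1) (j+1+1) = .rp))) := by
        intro n hn
        rcases hc n with hs | ⟨-, hs⟩
        · have := stepAt N hN _ _ hs (j+1+1) (by omega)
          rw [show j + 1 + 1 - 1 = j + 1 by omega, hv1 n hn] at this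
          exact this
        · left; rw [hs]
      by_cases hvi : v = .idle
      · refine evConst (fun n => c n (j+1+1)) rankB rankB_inj rankB_le n1 ?_
        intro n hn
        rcases key n hn with h | ⟨-, h⟩ | ⟨h, -⟩
        · simp [h]
        · simp only [h]; exact rankB_le _
        · simp [hvi] at h
      · refine evConst (fun n => c n (j+1+1)) rankA rankA_inj rankA_le n1 ?_
        intro n hn
        rcases key n hn with h | ⟨h, -⟩ | ⟨-, h | ⟨h, h'⟩⟩
        · simp [h]
        · exact absurd h hvi
        · simp [h, rankA]
        · simp [h, h', rankA]
  choose n1 v hn1 using hev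
  let M := (Finset.range N).sup n1
  have hnostep : ∀ st', ¬ pifStep N (c M) st' := by
    rcases hc M with hs | ⟨hs, -⟩
    · obtain ⟨j, hj, hjN, hne⟩ := stepChanges N hN _ _ hs
      have hle : n1 (j-1) ≤ M := Finset.le_sup (f := n1) (Finset.mem_range.2 (by omega))
      have e : j - 1 + 1 = j := by omega
      have a := hn1 (j-1) M hle
      have b := hn1 (j-1) (M+1) (by omega)
      rw [e] at a b
      exact absurd (b.trans a.symm) hne
    · exact hs
  rcases hinv M with ⟨l, m, h⟩ | ⟨k, h⟩
  · rcases rqLive N hN _ (hleaf M) l m h with ⟨st', h⟩ | ⟨l', m', h⟩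
    · exact hnostep st' h
    · exact (hcon M).1 l' m' h
  · obtain ⟨st', h⟩ := rpLive N hN _ k h
    exact hnostep st' h
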